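/- arXiv:2512.09877 — 5 statements merged into one kernel-verified Lean document; each statement's English description precedes it below -/
import Mathlib

section
/- Let k be a constant with 0 < k < 1. Then the function G(x) = cot(k · arccot x) is strictly convex and strictly increasing on (0, ∞); moreover lim_{x→0⁺} G(x) = cot(kπ/2), lim_{x→0⁺} G'(x) = k / sin²(kπ/2), and for all x ∈ (0, ∞) the inequalities cot(kπ/2) + k·x / sin²(kπ/2) < G(x) < cot(kπ/2) + x/k hold. -/
open Set Filter

noncomputable section

/-- The inverse cotangent with values in `(0, π)`. -/
def arccot (x : ℝ) : ℝ := Real.pi / 2 - Real.arctan x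

open Real in
theorem strictAntiOn_cos_mul_sin_sub {k : ℝ} (hk : 0 < k) (hk1 : k < 1) :
    StrictAntiOn (fun y : ℝ => cos y * sin (k * y) - k * (sin y * cos (k * y)))
      (Set.Icc 0 π) := by
  apply strictAntiOn_of_deriv_neg (convex_Icc _ _) (by fun_prop)
  intro y hy
  rw [interior_Icc] at hy
  have hd : HasDerivAt (fun y : ℝ => k * y) k y := by
    simpa using (hasDerivAt_id y).const_mul k
  have h := ((hasDerivAt_cos y).mul hd.sin).sub
    (((hasDerivAt_sin y).mul hd.cos).const_mul k)
  have h1 : 0 < sin y := sin_pos_of_pos_of_lt_pi hy.1 hy.2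
  have h2 : 0 < sin (k * y) :=
    sin_pos_of_pos_of_lt_pi (mul_pos hk hy.1) (by nlinarith [hy.1, hy.2])
  refine (h.deriv.trans ?_).trans_lt
    (neg_neg_of_pos (mul_pos (by nlinarith : 0 < 1 - k ^ 2) (mul_pos h1 h2)))
  ring

open Real in
theorem strictAntiOn_sin_div_sin_mul {k : ℝ} (hk : 0 < k) (hk1 : k < 1) :
    StrictAntiOn (fun y : ℝ => sin y / sin (k * y)) (Set.Ioo 0 π) := by
  have hpos : ∀ y ∈ Set.Ioo 0 π, 0 < sin (k * y) := fun y hy =>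
    sin_pos_of_pos_of_lt_pi (mul_pos hk hy.1) (by nlinarith [hy.1, hy.2])
  have hd : ∀ y ∈ Set.Ioo 0 π, HasDerivAt (fun y : ℝ => sin y / sin (k * y))
      ((cos y * sin (k * y) - sin y * (cos (k * y) * k)) / sin (k * y) ^ 2) y := by
    intro y hy
    have hd : HasDerivAt (fun y : ℝ => k * y) k y := by
      simpa using (hasDerivAt_id y).const_mul k
    exact (hasDerivAt_sin y).div hd.sin (hpos y hy).ne'
  apply strictAntiOn_of_deriv_neg (convex_Ioo _ _)
    fun y hy => (hd y hy).continuousAt.continuousWithinAt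
  intro y hy
  rw [interior_Ioo] at hy
  rw [(hd y hy).deriv]
  have h := strictAntiOn_cos_mul_sin_sub hk hk1 (Set.left_mem_Icc.2 pi_pos.le)
    (Set.Ioo_subset_Icc_self hy) hy.1
  simp only [mul_zero, sin_zero, zero_mul, sub_zero] at h
  exact div_neg_of_neg_of_pos (by linarith) (pow_pos (hpos y hy) 2)

open Real in
theorem mul_sin_lt_sin_mul {k y : ℝ} (hk : 0 < k) (hk1 : k < 1) (hy : 0 < y) (hy1 : y ≤ π) :
    k * sin y < sin (k * y) := by
  have h := strictConcaveOn_sin_Icc.2 (Set.left_mem_Icc.2 pi_pos.le) ⟨hy.le, hy1⟩ hy.ne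
    (sub_pos.2 hk1) hk (by ring)
  simpa using h

theorem arccot_mem_Ioo (x : ℝ) : arccot x ∈ Set.Ioo 0 Real.pi := by
  unfold arccot
  constructor <;> linarith [Real.neg_pi_div_two_lt_arctan x, Real.arctan_lt_pi_div_two x]

theorem sin_mul_arccot_pos {k : ℝ} (hk : 0 < k) (hk1 : k < 1) (x : ℝ) :
    0 < Real.sin (k * arccot x) := by
  have h := arccot_mem_Ioo x
  exact Real.sin_pos_of_pos_of_lt_pi (mul_pos hk h.1) (by nlinarith [h.1, h.2])

theorem strictAnti_arccot : StrictAnti arccot := fun _ _ h =>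
  sub_lt_sub_left (Real.arctan_strictMono h) _

theorem sin_arccot_sq (x : ℝ) : Real.sin (arccot x) ^ 2 = 1 / (1 + x ^ 2) := by
  rw [arccot, Real.sin_pi_div_two_sub, Real.cos_sq_arctan]

theorem continuous_arccot : Continuous arccot :=
  continuous_const.sub Real.continuous_arctan

theorem hasDerivAt_cot_mul_arccot {k : ℝ} (hk : 0 < k) (hk1 : k < 1) (x : ℝ) :
    HasDerivAt (fun x : ℝ => Real.cot (k * arccot x))
      (k * (Real.sin (arccot x) / Real.sin (k * arccot x)) ^ 2) x := by
  have hs := (sin_mul_arccot_pos hk hk1 x).ne'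
  have hd : HasDerivAt (fun x : ℝ => k * arccot x) (k * -(1 / (1 + x ^ 2))) x :=
    ((Real.hasDerivAt_arctan x).const_sub _).const_mul k
  have h := hd.cos.div hd.sin hs
  simp only [Real.cot_eq_cos_div_sin]
  refine h.congr_deriv ?_
  rw [← sin_arccot_sq]
  field_simp
  linear_combination (Real.sin (arccot x) ^ 2) * Real.sin_sq_add_cos_sq (k * arccot x)

theorem strictMono_deriv_cot_mul_arccot {k : ℝ} (hk : 0 < k) (hk1 : k < 1) :
    StrictMono fun x : ℝ => k * (Real.sin (arccot x) / Real.sin (k * arccot x)) ^ 2 := by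
  intro x y hxy
  have h := strictAntiOn_sin_div_sin_mul hk hk1 (arccot_mem_Ioo y) (arccot_mem_Ioo x)
    (strictAnti_arccot hxy)
  have hm := arccot_mem_Ioo x
  have h0 : 0 < Real.sin (arccot x) / Real.sin (k * arccot x) :=
    div_pos (Real.sin_pos_of_pos_of_lt_pi hm.1 hm.2) (sin_mul_arccot_pos hk hk1 x)
  exact mul_lt_mul_of_pos_left (pow_lt_pow_left₀ h h0.le two_ne_zero) hk

/-- For `0 < k < 1` the function `G(x) = cot(k·arccot x)` is strictly convex
and strictly increasing on `(0, ∞)`; `G(0⁺) = cot(kπ/2)`, `G'(0⁺) = k/sin²(kπ/2)`, and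
`cot(kπ/2) + k·x/sin²(kπ/2) < G(x) < cot(kπ/2) + x/k` for all `x > 0`. -/
theorem statement3 (k : ℝ) (hk : 0 < k) (hk1 : k < 1) :
    StrictConvexOn ℝ (Set.Ioi (0 : ℝ)) (fun x : ℝ => Real.cot (k * arccot x)) ∧
    StrictMonoOn (fun x : ℝ => Real.cot (k * arccot x)) (Set.Ioi (0 : ℝ)) ∧
    Tendsto (fun x : ℝ => Real.cot (k * arccot x)) (nhdsWithin 0 (Set.Ioi 0))
      (nhds (Real.cot (k * Real.pi / 2))) ∧
    Tendsto (deriv (fun x : ℝ => Real.cot (k * arccot x))) (nhdsWithin 0 (Set.Ioi 0))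
      (nhds (k / Real.sin (k * Real.pi / 2) ^ 2)) ∧
    ∀ x : ℝ, 0 < x →
      Real.cot (k * Real.pi / 2) + k * x / Real.sin (k * Real.pi / 2) ^ 2 <
        Real.cot (k * arccot x) ∧
      Real.cot (k * arccot x) < Real.cot (k * Real.pi / 2) + x / k := by
  have hd := hasDerivAt_cot_mul_arccot hk hk1
  have hderiv := deriv_eq hd
  have hmono := strictMono_deriv_cot_mul_arccot hk hk1
  have hcont : Continuous fun x : ℝ => Real.cot (k * arccot x) :=
    continuous_iff_continuousAt.2 fun x => (hd x).continuousAt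
  have h0 : k * arccot 0 = k * Real.pi / 2 := by
    rw [arccot, Real.arctan_zero]
    ring
  have hD0 : k * (Real.sin (arccot 0) / Real.sin (k * arccot 0)) ^ 2 =
      k / Real.sin (k * Real.pi / 2) ^ 2 := by
    rw [div_pow, sin_arccot_sq, h0]
    simp [div_eq_mul_inv]
  refine ⟨?_, ?_, ?_, ?_, fun x hx => ?_⟩
  · refine StrictMonoOn.strictConvexOn_of_deriv (convex_Ioi 0) hcont.continuousOn ?_
    rw [hderiv]
    exact hmono.strictMonoOn _
  · refine (strictMono_of_deriv_pos fun x => ?_).strictMonoOn _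
    have hm := arccot_mem_Ioo x
    rw [(hd x).deriv]
    exact mul_pos hk (pow_pos (div_pos (Real.sin_pos_of_pos_of_lt_pi hm.1 hm.2)
      (sin_mul_arccot_pos hk hk1 x)) 2)
  · rw [← h0]
    exact hcont.continuousAt.tendsto.mono_left nhdsWithin_le_nhds
  · rw [hderiv, ← hD0]
    have hc : Continuous fun x : ℝ =>
        k * (Real.sin (arccot x) / Real.sin (k * arccot x)) ^ 2 :=
      continuous_const.mul (((Real.continuous_sin.comp continuous_arccot).div
        (Real.continuous_sin.comp (continuous_const.mul continuous_arccot))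
        fun x => (sin_mul_arccot_pos hk hk1 x).ne').pow 2)
    exact hc.continuousAt.tendsto.mono_left nhdsWithin_le_nhds
  · obtain ⟨c, hc, hslope⟩ := exists_hasDerivAt_eq_slope _ _ hx hcont.continuousOn
      fun y _ => hd y
    rw [h0, sub_zero, eq_div_iff hx.ne'] at hslope
    have hlow := hmono hc.1
    simp only [hD0] at hlow
    have hm := arccot_mem_Ioo c
    have hup : k * (Real.sin (arccot c) / Real.sin (k * arccot c)) ^ 2 < 1 / k := by
      have hs := sin_mul_arccot_pos hk hk1 c
      have hsin := Real.sin_pos_of_pos_of_lt_pi hm.1 hm.2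
      have hlt := mul_sin_lt_sin_mul hk hk1 hm.1 hm.2.le
      rw [lt_div_iff₀ hk]
      calc k * (Real.sin (arccot c) / Real.sin (k * arccot c)) ^ 2 * k
          = (k * Real.sin (arccot c) / Real.sin (k * arccot c)) ^ 2 := by ring
        _ < 1 := pow_lt_one₀ (by positivity) ((div_lt_one hs).2 hlt) two_ne_zero
    have h1 := mul_lt_mul_of_pos_right hlow hx
    have h2 := mul_lt_mul_of_pos_right hup hx
    rw [div_mul_eq_mul_div] at h1 h2
    rw [one_mul] at h2
    constructor <;> linarith

end
end

section
/- For every p ∈ (0,1), the quantity N_p(4) = ((1+p²) log 2)/p · cot²( (1/4) · arccot( 5/3 + 17(1−p²)² / (6p(8p + 5(1+p²))) ) ) satisfies N_p(4) < ((1+p²) log 2)/p · (1 + √2 + 20/(3p))². -/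
noncomputable section

/-- The slope of `y ↦ cot (arccot y / 4)` is at most `4` and its value at `0` is `cot (π / 8)`. -/
theorem cot_quarter_arccot_le {y : ℝ} (hy : 0 < y) :
    0 < Real.cot ((1 / 4) * arccot y) ∧
      Real.cot ((1 / 4) * arccot y) ≤ 1 + Real.sqrt 2 + 4 * y := by
  set φ : ℝ := (1 / 4) * arccot y with hφ
  have htan4 : Real.tan (2 * (2 * φ)) = y⁻¹ := by
    have h : 2 * (2 * φ) = Real.pi / 2 - Real.arctan y := by
      rw [hφ, arccot]; ring
    rw [h, Real.tan_pi_div_two_sub, Real.tan_arctan]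
  have hφ0 : 0 < φ := by
    have := Real.arctan_lt_pi_div_two y
    rw [hφ, arccot]; linarith
  have hφ1 : φ < Real.pi / 8 := by
    have := Real.arctan_pos.2 hy
    rw [hφ, arccot]; linarith
  have hv0 : 0 < Real.tan (2 * φ) :=
    Real.tan_pos_of_pos_of_lt_pi_div_two (by linarith) (by linarith)
  have hv1 : Real.tan (2 * φ) < 1 := by
    rw [← Real.tan_pi_div_four]
    exact Real.tan_lt_tan_of_nonneg_of_lt_pi_div_two (by linarith) (by linarith) (by linarith)
  have hu0 : 0 < Real.tan φ := Real.tan_pos_of_pos_of_lt_pi_div_two hφ0 (by linarith)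
  have hu1 : Real.tan φ < 1 := by
    rw [← Real.tan_pi_div_four]
    exact Real.tan_lt_tan_of_nonneg_of_lt_pi_div_two (by linarith) (by linarith) (by linarith)
  have huv : Real.tan (2 * φ) = 2 * Real.tan φ / (1 - Real.tan φ ^ 2) := Real.tan_two_mul
  have hvy : y⁻¹ = 2 * Real.tan (2 * φ) / (1 - Real.tan (2 * φ) ^ 2) := by
    rw [← htan4, Real.tan_two_mul]
  have hcot : Real.cot φ = (Real.tan φ)⁻¹ := by
    rw [Real.cot_eq_cos_div_sin, Real.tan_eq_sin_div_cos, inv_div]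
  rw [hcot]
  generalize Real.tan (2 * φ) = v at *
  generalize Real.tan φ = u at *
  refine ⟨inv_pos.2 hu0, ?_⟩
  have hu2 : 0 < 1 - u ^ 2 := by nlinarith
  have hy' : 4 * y = 2 * (v⁻¹ - v) := by
    rw [← inv_inv y, hvy]
    field_simp
    ring
  have hv' : 2 * v⁻¹ = u⁻¹ - u := by
    rw [huv]
    field_simp
  have hu : u ≤ Real.sqrt 2 - 1 := by
    have h : 2 * u < 1 - u ^ 2 := by rwa [huv, div_lt_one hu2] at hv1
    have : u + 1 ≤ Real.sqrt 2 := Real.le_sqrt_of_sq_le (by nlinarith)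
    linarith
  linarith

/-- For every `p ∈ (0,1)`,
`N_p(4) = ((1+p²) log 2)/p · cot²((1/4)·arccot(5/3 + 17(1−p²)²/(6p(8p + 5(1+p²)))))`
satisfies `N_p(4) < ((1+p²) log 2)/p · (1 + √2 + 20/(3p))²`. -/
theorem statement8 (p : ℝ) (hp : p ∈ Set.Ioo (0 : ℝ) 1) :
    ((1 + p ^ 2) * Real.log 2) / p *
      (Real.cot ((1 / 4) * arccot (5 / 3 +
        17 * (1 - p ^ 2) ^ 2 / (6 * p * (8 * p + 5 * (1 + p ^ 2)))))) ^ 2 <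
    ((1 + p ^ 2) * Real.log 2) / p * (1 + Real.sqrt 2 + 20 / (3 * p)) ^ 2 := by
  obtain ⟨hp0, hp1⟩ := hp
  set y : ℝ := 5 / 3 + 17 * (1 - p ^ 2) ^ 2 / (6 * p * (8 * p + 5 * (1 + p ^ 2))) with hy
  have hy0 : 0 < y := by positivity
  have hy1 : y < 5 / (3 * p) := by
    have hlt : 17 * (1 - p ^ 2) ^ 2 / (6 * p * (8 * p + 5 * (1 + p ^ 2))) <
        5 * (1 - p) / (3 * p) := by
      rw [div_lt_div_iff₀ (by positivity) (by positivity)]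
      have h : 0 < 10 * (8 * p + 5 * (1 + p ^ 2)) - 17 * (1 - p) * (1 + p) ^ 2 := by
        nlinarith [pow_pos hp0 2, pow_pos hp0 3]
      have h' : 0 < 3 * p * (1 - p) := by nlinarith
      nlinarith [mul_pos h' h]
    have heq : 5 / (3 * p) = 5 / 3 + 5 * (1 - p) / (3 * p) := by
      field_simp
      ring
    rw [hy, heq]
    linarith
  obtain ⟨hc0, hc1⟩ := cot_quarter_arccot_le hy0
  have hlog : 0 < Real.log 2 := Real.log_pos one_lt_two
  have heq : 20 / (3 * p) = 4 * (5 / (3 * p)) := by ring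
  have hc2 : Real.cot ((1 / 4) * arccot y) < 1 + Real.sqrt 2 + 20 / (3 * p) := by
    linarith
  gcongr

end
end

section
/- Let 0 < p < 1, q > 1, and 1 ≤ T ≤ q. Then (q + T²)/T + (1−p²)²(1+T²)(q²+T²) / (4pT²(4p√q + (1+q)(1+p²))) ≤ 1 + q + (1−p²)²(1+q²) / (2p(4p√q + (1+q)(1+p²))). -/
/-- For `0 < p < 1`, `q > 1` and `1 ≤ T ≤ q`,
`(q + T²)/T + (1−p²)²(1+T²)(q²+T²)/(4pT²(4p√q + (1+q)(1+p²)))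
  ≤ 1 + q + (1−p²)²(1+q²)/(2p(4p√q + (1+q)(1+p²)))`. -/
theorem statement9 (p q T : ℝ) (hp0 : 0 < p) (hp1 : p < 1) (hq : 1 < q)
    (hT1 : 1 ≤ T) (hTq : T ≤ q) :
    (q + T ^ 2) / T +
      (1 - p ^ 2) ^ 2 * (1 + T ^ 2) * (q ^ 2 + T ^ 2) /
        (4 * p * T ^ 2 * (4 * p * Real.sqrt q + (1 + q) * (1 + p ^ 2))) ≤
    1 + q +
      (1 - p ^ 2) ^ 2 * (1 + q ^ 2) /
        (2 * p * (4 * p * Real.sqrt q + (1 + q) * (1 + p ^ 2))) := by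
  have hT : 0 < T := by linarith
  have hD : 0 < 4 * p * Real.sqrt q + (1 + q) * (1 + p ^ 2) := by positivity
  generalize 4 * p * Real.sqrt q + (1 + q) * (1 + p ^ 2) = D at hD ⊢
  have h₁ : 0 ≤ (T - 1) * (q - T) / T :=
    div_nonneg (mul_nonneg (by linarith) (by linarith)) hT.le
  have h₂ : 0 ≤ (1 - p ^ 2) ^ 2 * ((T ^ 2 - 1) * (q ^ 2 - T ^ 2)) / (4 * p * T ^ 2 * D) :=
    div_nonneg (mul_nonneg (sq_nonneg _) (mul_nonneg (by nlinarith) (by nlinarith)))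
      (by positivity)
  have e₁ : 1 + q - (q + T ^ 2) / T = (T - 1) * (q - T) / T := by
    field_simp
    ring
  have e₂ : (1 - p ^ 2) ^ 2 * (1 + q ^ 2) / (2 * p * D) -
      (1 - p ^ 2) ^ 2 * (1 + T ^ 2) * (q ^ 2 + T ^ 2) / (4 * p * T ^ 2 * D) =
      (1 - p ^ 2) ^ 2 * ((T ^ 2 - 1) * (q ^ 2 - T ^ 2)) / (4 * p * T ^ 2 * D) := by
    field_simp
    ring
  linarith
end

section
/- Let p ∈ (0,1), set α = 2p/(1+p²), Δ̄_p = {ζ ∈ ℂ : |ζ − α⁻¹| ≤ √(α⁻² − 1)}, and Ω = 𝔻 \ Δ̄_p. Then the function φ_α(ζ) = ζ(1 − αζ)/(ζ − α) is injective on Ω, maps Ω onto the unit disk 𝔻, and satisfies φ_α(0) = 0 and φ_α'(0) = −α⁻¹. -/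
noncomputable section

/-- The open unit disk in `ℂ`. -/
def unitDisk : Set ℂ := Metric.ball 0 1

/-- `α = 2p/(1+p²)`. -/
def alpha (p : ℝ) : ℝ := 2 * p / (1 + p ^ 2)

/-- The closed disk `Δ̄_p = {ζ : |ζ − α⁻¹| ≤ √(α⁻² − 1)}`. -/
def Delta (p : ℝ) : Set ℂ :=
  Metric.closedBall (((alpha p)⁻¹ : ℝ) : ℂ) (Real.sqrt (((alpha p)⁻¹) ^ 2 - 1))

/-- The conformal map `φ_α(ζ) = ζ(1 − αζ)/(ζ − α)`. -/
def phi (α : ℝ) (z : ℂ) : ℂ := z * (1 - (α : ℂ) * z) / (z - (α : ℂ))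

theorem alpha_mem_Ioo {p : ℝ} (hp : p ∈ Set.Ioo (0 : ℝ) 1) : alpha p ∈ Set.Ioo (0 : ℝ) 1 := by
  obtain ⟨h0, h1⟩ := hp
  refine ⟨by unfold alpha; positivity, ?_⟩
  rw [alpha, div_lt_one (by positivity)]
  nlinarith [sq_pos_of_pos (sub_pos.2 h1)]

theorem norm_lt_norm_iff_normSq {z w : ℂ} :
    ‖z‖ < ‖w‖ ↔ Complex.normSq z < Complex.normSq w := by
  rw [Complex.normSq_eq_norm_sq, Complex.normSq_eq_norm_sq]
  exact (sq_lt_sq₀ (norm_nonneg _) (norm_nonneg _)).symm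

theorem mem_unitDisk_iff {z : ℂ} : z ∈ unitDisk ↔ Complex.normSq z < 1 := by
  simpa [unitDisk] using norm_lt_norm_iff_normSq (z := z) (w := 1)

theorem notMem_Delta_iff {p : ℝ} (hp : p ∈ Set.Ioo (0 : ℝ) 1) {z : ℂ} :
    z ∉ Delta p ↔ 0 < alpha p * (1 + Complex.normSq z) - 2 * z.re := by
  obtain ⟨h0, h1⟩ := alpha_mem_Ioo hp
  have key : Complex.normSq (z - (((alpha p)⁻¹ : ℝ) : ℂ)) - ((alpha p)⁻¹ ^ 2 - 1) =
      (alpha p)⁻¹ * (alpha p * (1 + Complex.normSq z) - 2 * z.re) := by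
    simp only [Complex.normSq_apply, Complex.sub_re, Complex.sub_im, Complex.ofReal_re,
      Complex.ofReal_im]
    field_simp
    ring
  have hnonneg : 0 ≤ (alpha p)⁻¹ ^ 2 - 1 :=
    sub_nonneg.2 (one_le_pow₀ ((one_le_inv₀ h0).2 h1.le))
  rw [Delta, Metric.mem_closedBall, not_le, Complex.dist_eq,
    Real.sqrt_lt hnonneg (norm_nonneg _), ← Complex.normSq_eq_norm_sq, ← sub_pos, key,
    mul_pos_iff_of_pos_left (inv_pos.2 h0)]

theorem normSq_sub_sub_normSq_mul (a : ℝ) (z : ℂ) :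
    Complex.normSq (z - a) - Complex.normSq (z * (1 - a * z)) =
      a * (1 - Complex.normSq z) * (a * (1 + Complex.normSq z) - 2 * z.re) := by
  simp [Complex.normSq_apply]
  ring

theorem norm_phi_lt_one_iff {a : ℝ} (ha : 0 < a) {z : ℂ} (hza : z ≠ a)
    (hz : Complex.normSq z < 1) :
    ‖phi a z‖ < 1 ↔ 0 < a * (1 + Complex.normSq z) - 2 * z.re := by
  rw [phi, norm_div, div_lt_one (norm_pos_iff.2 (sub_ne_zero.2 hza)),
    norm_lt_norm_iff_normSq, ← sub_pos, normSq_sub_sub_normSq_mul,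
    mul_pos_iff_of_pos_left (mul_pos ha (sub_pos.2 hz))]

theorem eq_of_phi_eq {a : ℝ} (ha : a ∈ Set.Ioo (0 : ℝ) 1) {z w : ℂ} (hza : z ≠ a) (hwa : w ≠ a)
    (hz : Complex.normSq z < 1) (hw : Complex.normSq w < 1) (h : phi a z = phi a w) : z = w := by
  obtain ⟨h0, h1⟩ := ha
  rw [phi, phi, div_eq_div_iff (sub_ne_zero.2 hza) (sub_ne_zero.2 hwa)] at h
  have hfac : (z - w) * (w * (a - z) - (1 - a * z)) * a = 0 := by linear_combination h
  rcases mul_eq_zero.1 hfac with hfac | hfac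
  · rcases mul_eq_zero.1 hfac with hfac | hfac
    · exact sub_eq_zero.1 hfac
    · exfalso
      have hn := congrArg Complex.normSq (sub_eq_zero.1 hfac)
      rw [Complex.normSq_mul] at hn
      have hid : Complex.normSq (1 - a * z) - Complex.normSq (a - z) =
          (1 - a ^ 2) * (1 - Complex.normSq z) := by
        simp [Complex.normSq_apply]
        ring
      have hpos : 0 < (1 - a ^ 2) * (1 - Complex.normSq z) :=
        mul_pos (by nlinarith) (sub_pos.2 hz)
      nlinarith [Complex.normSq_nonneg (a - z)]
  · exact absurd (Complex.ofReal_eq_zero.1 hfac) h0.ne'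

theorem exists_phi_eq {a : ℝ} (ha : a ∈ Set.Ioo (0 : ℝ) 1) {c : ℂ} (hc : ‖c‖ < 1) :
    ∃ z : ℂ, z ≠ a ∧ Complex.normSq z < 1 ∧ phi a z = c := by
  obtain ⟨h0, h1⟩ := ha
  have ha' : (a : ℂ) ≠ 0 := Complex.ofReal_ne_zero.2 h0.ne'
  have root_spec : ∀ z : ℂ, a * (z * z) + (c - 1) * z + -(c * a) = 0 →
      z ≠ a ∧ phi a z = c := by
    intro z hz
    have hza : z ≠ a := by
      rintro rfl
      have : (a : ℂ) * (a ^ 2 - 1) = 0 := by linear_combination hz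
      have : a * (a ^ 2 - 1) = 0 := by exact_mod_cast this
      nlinarith
    refine ⟨hza, ?_⟩
    rw [phi, div_eq_iff (sub_ne_zero.2 hza)]
    linear_combination -hz
  obtain ⟨z, hz⟩ := exists_quadratic_eq_zero (b := c - 1) (c := -(c * a)) ha'
    (IsAlgClosed.exists_eq_mul_self _)
  obtain ⟨w, hw⟩ : ∃ w : ℂ, a * w = 1 - c - a * z := ⟨(1 - c - a * z) / a, by field_simp⟩
  have hzw : z * w = -c := mul_left_cancel₀ ha' (by linear_combination z * hw - hz)
  have hw' : a * (w * w) + (c - 1) * w + -(c * a) = 0 := by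
    linear_combination w * hw - a * hzw
  have hn : Complex.normSq z * Complex.normSq w < 1 := by
    rw [← Complex.normSq_mul, hzw, Complex.normSq_neg, ← mem_unitDisk_iff]
    exact mem_ball_zero_iff.2 hc
  by_cases h : Complex.normSq z < 1
  · exact ⟨z, (root_spec z hz).1, h, (root_spec z hz).2⟩
  · refine ⟨w, (root_spec w hw').1, ?_, (root_spec w hw').2⟩
    nlinarith [Complex.normSq_nonneg w]

theorem deriv_phi_zero {a : ℝ} (ha : a ≠ 0) : deriv (phi a) 0 = -((a⁻¹ : ℝ) : ℂ) := by
  have ha' : (a : ℂ) ≠ 0 := Complex.ofReal_ne_zero.2 ha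
  have hnum : HasDerivAt (fun z : ℂ => z * (1 - a * z)) 1 0 := by
    refine ((hasDerivAt_id (0 : ℂ)).mul
      (((hasDerivAt_id (0 : ℂ)).const_mul (a : ℂ)).const_sub 1)).congr_deriv ?_
    simp
  have hdiv := hnum.div ((hasDerivAt_id (0 : ℂ)).sub_const (a : ℂ)) (by simpa using ha')
  refine HasDerivAt.deriv (hdiv.congr_deriv ?_)
  simp
  field_simp

theorem ne_alpha_of_notMem_Delta {p : ℝ} (hp : p ∈ Set.Ioo (0 : ℝ) 1) {z : ℂ}
    (hz : z ∉ Delta p) : z ≠ alpha p := by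
  obtain ⟨h0, h1⟩ := alpha_mem_Ioo hp
  rintro rfl
  rw [notMem_Delta_iff hp, Complex.normSq_ofReal, Complex.ofReal_re] at hz
  nlinarith [mul_pos h0 (show 0 < 1 - alpha p * alpha p by nlinarith)]

/-- For `p ∈ (0,1)`, `α = 2p/(1+p²)` and `Ω = 𝔻 \ Δ̄_p`, the function
`φ_α(ζ) = ζ(1 − αζ)/(ζ − α)` is injective on `Ω`, maps `Ω` onto the unit disk, and
satisfies `φ_α(0) = 0` and `φ_α'(0) = −α⁻¹`. -/
theorem statement13 (p : ℝ) (hp : p ∈ Set.Ioo (0 : ℝ) 1) :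
    Set.InjOn (phi (alpha p)) (unitDisk \ Delta p) ∧
    phi (alpha p) '' (unitDisk \ Delta p) = Metric.ball 0 1 ∧
    phi (alpha p) 0 = 0 ∧
    deriv (phi (alpha p)) 0 = -((((alpha p)⁻¹ : ℝ) : ℂ)) := by
  have ha := alpha_mem_Ioo hp
  refine ⟨?_, ?_, by simp [phi], deriv_phi_zero ha.1.ne'⟩
  · rintro z ⟨hz, hzD⟩ w ⟨hw, hwD⟩ h
    exact eq_of_phi_eq ha (ne_alpha_of_notMem_Delta hp hzD) (ne_alpha_of_notMem_Delta hp hwD)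
      (mem_unitDisk_iff.1 hz) (mem_unitDisk_iff.1 hw) h
  · ext c
    rw [mem_ball_zero_iff]
    constructor
    · rintro ⟨z, ⟨hz, hzD⟩, rfl⟩
      exact (norm_phi_lt_one_iff ha.1 (ne_alpha_of_notMem_Delta hp hzD)
        (mem_unitDisk_iff.1 hz)).2 ((notMem_Delta_iff hp).1 hzD)
    · intro hc
      obtain ⟨z, hza, hz, rfl⟩ := exists_phi_eq ha hc
      exact ⟨z, ⟨mem_unitDisk_iff.2 hz,
        (notMem_Delta_iff hp).2 ((norm_phi_lt_one_iff ha.1 hza hz).1 hc)⟩, rfl⟩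

end
end

section
/- Let p ∈ (0,1), 0 < a < b, and set ψ(z) = ((z + p)/(z + 1/p))², A = ψ(a), B = ψ(b). Then for every y ∈ [a, b], with ζ = ψ(iy), the angle θ = arg((B − ζ)/(A − ζ)) ∈ (0, π/2] subtended by the segment [A, B] at ζ satisfies cot θ ≤ M_p(b/a), where M_p(q) = (q+1)/(q−1) + (1−p²)²(1+q²) / (2p(q−1)(4p√q + (1+q)(1+p²))); equivalently, θ ≥ arccot M_p(b/a). -/
noncomputable section

/-- The map `ψ(z) = ((z + p)/(z + 1/p))²`. -/
def psi (p : ℝ) (z : ℂ) : ℂ := ((z + (p : ℂ)) / (z + 1 / (p : ℂ))) ^ 2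

/-- The constant `M_p(q)`. -/
def Mp (p q : ℝ) : ℝ :=
  (q + 1) / (q - 1) +
    (1 - p ^ 2) ^ 2 * (1 + q ^ 2) /
      (2 * p * (q - 1) * (4 * p * Real.sqrt q + (1 + q) * (1 + p ^ 2)))

/-- The difference of two values of `ψ`, factored. -/
lemma psi_sub_psi (p : ℝ) (hp : p ≠ 0) (u z : ℂ) (hu : u + 1 / (p : ℂ) ≠ 0)
    (hz : z + 1 / (p : ℂ) ≠ 0) :
    psi p u - psi p z =
      (1 / (p : ℂ) - p) * ((u - z) * (2 * u * z + (p + 1 / p) * (u + z) + 2)) /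
        ((u + 1 / p) ^ 2 * (z + 1 / p) ^ 2) := by
  have hpc : (p : ℂ) ≠ 0 := by exact_mod_cast hp
  obtain ⟨r, hr⟩ : ∃ r : ℂ, r = 1 / (p : ℂ) := ⟨_, rfl⟩
  have hpr : (p : ℂ) * r = 1 := by rw [hr]; field_simp
  unfold psi
  rw [← hr] at hu hz ⊢
  rw [div_pow, div_pow, div_sub_div _ _ (pow_ne_zero 2 hu) (pow_ne_zero 2 hz)]
  congr 1
  linear_combination (2 * (r - p) * (u - z)) * hpr

/-- Up to a positive real factor, `(ψ(b) - ψ(iy)) / (ψ(a) - ψ(iy))` has an explicit real and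
imaginary part. -/
lemma exists_psi_ratio_eq (p a b y : ℝ) (hp0 : 0 < p) (hp1 : p < 1) (ha : 0 < a) (hb : 0 < b)
    (hy : 0 < y) :
    ∃ c : ℝ, 0 < c ∧
      (psi p (b : ℂ) - psi p ((y : ℂ) * Complex.I)) /
          (psi p (a : ℂ) - psi p ((y : ℂ) * Complex.I)) =
        (c : ℂ) *
          (((a * b + y ^ 2) * (1 + y ^ 2) * (4 * (1 + a * b) + 2 * (p + 1 / p) * (a + b)) +
              (1 / p - p) ^ 2 * ((a ^ 2 + y ^ 2) * (b ^ 2 + y ^ 2)) : ℝ) +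
            (y * (b - a) * (1 + y ^ 2) *
              (4 * (1 + a * b) + 2 * (p + 1 / p) * (a + b)) : ℝ) * Complex.I) := by
  obtain ⟨r, hr⟩ : ∃ r : ℝ, r = 1 / p := ⟨_, rfl⟩
  have hpr : p * r = 1 := by rw [hr]; field_simp
  have hr1 : 1 < r := by rw [hr, lt_div_iff₀ hp0]; linarith
  have hrc : 1 / (p : ℂ) = (r : ℂ) := by rw [hr]; push_cast; rfl
  have ne_of_re (w : ℂ) (h : 0 < w.re) : w ≠ 0 := by
    rintro rfl
    simp at h
  have hA : (a : ℂ) + 1 / (p : ℂ) ≠ 0 := by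
    rw [hrc]; apply ne_of_re; simp; positivity
  have hB : (b : ℂ) + 1 / (p : ℂ) ≠ 0 := by
    rw [hrc]; apply ne_of_re; simp; positivity
  have hY : (y : ℂ) * Complex.I + 1 / (p : ℂ) ≠ 0 := by
    rw [hrc]; apply ne_of_re; simp; positivity
  rw [psi_sub_psi p hp0.ne' _ _ hA hY, psi_sub_psi p hp0.ne' _ _ hB hY, ← hr]
  rw [hrc] at hA hB hY ⊢
  have hd : (r : ℂ) - p ≠ 0 := by
    rw [← Complex.ofReal_sub]
    exact_mod_cast (by linarith : 0 < r - p).ne'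
  have hE : (a : ℂ) - y * Complex.I ≠ 0 := by
    apply ne_of_re; simpa using ha
  have hN : (2 * a * (y * Complex.I) + (p + r) * (a + y * Complex.I) + 2 : ℂ) ≠ 0 := by
    apply ne_of_re; simp; positivity
  have hprc : (p : ℂ) * r = 1 := by exact_mod_cast hpr
  have hsq : Complex.I ^ 2 = -1 := Complex.I_sq
  refine ⟨(a + r) ^ 2 / ((b + r) ^ 2 * ((a ^ 2 + y ^ 2) *
    (((p + r) * a + 2) ^ 2 + y ^ 2 * (2 * a + (p + r)) ^ 2))), by positivity, ?_⟩
  have hnE : ((a : ℂ) ^ 2 + y ^ 2) ≠ 0 := by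
    exact_mod_cast (by positivity : a ^ 2 + y ^ 2 ≠ 0)
  have hnN : (((p + r) * a + 2) ^ 2 + y ^ 2 * (2 * a + (p + r)) ^ 2 : ℂ) ≠ 0 := by
    exact_mod_cast
      (by positivity : ((p + r) * a + 2) ^ 2 + y ^ 2 * (2 * a + (p + r)) ^ 2 ≠ 0)
  have hE' : ((a : ℂ) - y * Complex.I) * (a + y * Complex.I) = a ^ 2 + y ^ 2 := by
    linear_combination (-(y : ℂ) ^ 2) * hsq
  have hN' : (2 * a * (y * Complex.I) + (p + r) * (a + y * Complex.I) + 2 : ℂ) *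
      (((p + r) * a + 2) - y * (2 * a + (p + r)) * Complex.I) =
      ((p + r) * a + 2) ^ 2 + y ^ 2 * (2 * a + (p + r)) ^ 2 := by
    linear_combination (-(y : ℂ) ^ 2 * (2 * a + (p + r)) ^ 2) * hsq
  have hfirst : ((b : ℂ) - y * Complex.I) * (a + y * Complex.I) =
      (a * b + y ^ 2) + y * (b - a) * Complex.I := by
    linear_combination (-(y : ℂ) ^ 2) * hsq
  have hsecond : (2 * b * (y * Complex.I) + (p + r) * (b + y * Complex.I) + 2 : ℂ) *
      (((p + r) * a + 2) - y * (2 * a + (p + r)) * Complex.I) =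
      ((1 + y ^ 2) * (4 * (1 + a * b) + 2 * (p + r) * (a + b)) +
        (r - p) ^ 2 * (a * b + y ^ 2)) - y * (b - a) * (r - p) ^ 2 * Complex.I := by
    linear_combination (-(y : ℂ) ^ 2 * (2 * a + (p + r)) * (2 * b + (p + r))) * hsq +
      (4 * (a * b + y ^ 2) - 4 * y * (b - a) * Complex.I) * hprc
  have hprod : ((b : ℂ) - y * Complex.I) *
        (2 * b * (y * Complex.I) + (p + r) * (b + y * Complex.I) + 2) *
        ((a ^ 2 + y ^ 2) * (((p + r) * a + 2) ^ 2 + y ^ 2 * (2 * a + (p + r)) ^ 2)) =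
      ((a : ℂ) - y * Complex.I) *
        (2 * a * (y * Complex.I) + (p + r) * (a + y * Complex.I) + 2) *
        (((a * b + y ^ 2) * (1 + y ^ 2) * (4 * (1 + a * b) + 2 * (p + r) * (a + b)) +
              (r - p) ^ 2 * ((a ^ 2 + y ^ 2) * (b ^ 2 + y ^ 2))) +
            (y * (b - a) * (1 + y ^ 2) *
              (4 * (1 + a * b) + 2 * (p + r) * (a + b))) * Complex.I) := by
    have hmul : ∀ e f e' f' u v n m k : ℂ, e * e' = n → f * f' = m → u * e' * (v * f') = k →
        u * v * (n * m) = e * f * k := by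
      rintro e f e' f' u v n m k rfl rfl rfl
      ring
    refine hmul _ _ _ _ _ _ _ _ _ hE' hN' ?_
    rw [hfirst, hsecond]
    linear_combination (-(y : ℂ) ^ 2 * (b - a) ^ 2 * (r - p) ^ 2) * hsq
  have hcancel : ∀ d u v A B Y n w : ℂ, d ≠ 0 → u ≠ 0 → A ≠ 0 → B ≠ 0 → Y ≠ 0 → n ≠ 0 →
      v * n = u * w →
      d * v / (B ^ 2 * Y ^ 2) / (d * u / (A ^ 2 * Y ^ 2)) = A ^ 2 / (B ^ 2 * n) * w := by
    intro d u v A B Y n w hd hu hA hB hY hn h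
    field_simp
    linear_combination h
  push_cast
  exact hcancel _ _ _ _ _ _ _ _ hd (mul_ne_zero hE hN) hA hB hY (mul_ne_zero hnE hnN) hprod

/-- The real bound behind the cotangent estimate. -/
lemma cot_bound_le_Mp (p a b y : ℝ) (hp0 : 0 < p) (ha : 0 < a) (hab : a < b)
    (hay : a ≤ y) (hyb : y ≤ b) :
    ((a * b + y ^ 2) * (1 + y ^ 2) * (4 * (1 + a * b) + 2 * (p + 1 / p) * (a + b)) +
        (1 / p - p) ^ 2 * ((a ^ 2 + y ^ 2) * (b ^ 2 + y ^ 2))) /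
      (y * (b - a) * (1 + y ^ 2) * (4 * (1 + a * b) + 2 * (p + 1 / p) * (a + b))) ≤
      Mp p (b / a) := by
  have hb : 0 < b := ha.trans hab
  have hy : 0 < y := ha.trans_le hay
  have hD : 0 < b - a := sub_pos.2 hab
  obtain ⟨g, hg⟩ : ∃ g, g = √(a * b) := ⟨_, rfl⟩
  have hg0 : 0 ≤ g := hg ▸ Real.sqrt_nonneg _
  have hg2 : g ^ 2 = a * b := by rw [hg, Real.sq_sqrt (by positivity)]
  have hsqrt : √(b / a) = g / a := by
    rw [Real.sqrt_eq_iff_mul_self_eq (by positivity) (by positivity)]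
    field_simp
    linarith
  obtain ⟨s, hs⟩ : ∃ s, s = p + 1 / p := ⟨_, rfl⟩
  have hs0 : 0 < s := by rw [hs]; positivity
  have hM : Mp p (b / a) = (a + b) / (b - a) +
      (1 / p - p) ^ 2 * ((a ^ 2 + b ^ 2) / (2 * (b - a) * (4 * g + s * (a + b)))) := by
    have hq : b / a - 1 = (b - a) / a := by field_simp
    unfold Mp
    rw [hsqrt, hs, hq]
    have h4 : 0 < 4 * p * g + (a + b) * (1 + p ^ 2) := by positivity
    have e1 : 4 * p * (g / a) + (1 + b / a) * (1 + p ^ 2) =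
        (4 * p * g + (a + b) * (1 + p ^ 2)) / a := by field_simp
    have e2 : 4 * g + (p + 1 / p) * (a + b) = (4 * p * g + (a + b) * (1 + p ^ 2)) / p := by
      field_simp
      ring
    rw [e1, e2]
    field_simp
    ring
  have hsplit : ((a * b + y ^ 2) * (1 + y ^ 2) * (4 * (1 + a * b) + 2 * s * (a + b)) +
        (1 / p - p) ^ 2 * ((a ^ 2 + y ^ 2) * (b ^ 2 + y ^ 2))) /
      (y * (b - a) * (1 + y ^ 2) * (4 * (1 + a * b) + 2 * s * (a + b))) =
      (a * b + y ^ 2) / (y * (b - a)) + (1 / p - p) ^ 2 *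
        ((a ^ 2 + y ^ 2) * (b ^ 2 + y ^ 2) /
          (y * (b - a) * (1 + y ^ 2) * (4 * (1 + a * b) + 2 * s * (a + b)))) := by
    have hK : 0 < 4 * (1 + a * b) + 2 * s * (a + b) := by positivity
    generalize 4 * (1 + a * b) + 2 * s * (a + b) = K at *
    generalize (1 / p - p) ^ 2 = t
    field_simp
  rw [hM, ← hs, hsplit]
  gcongr ?_ + _ * ?_
  · rw [div_le_div_iff₀ (by positivity) hD]
    nlinarith [mul_nonneg hD.le (mul_nonneg (sub_nonneg.2 hay) (sub_nonneg.2 hyb))]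
  · rw [div_le_div_iff₀ (by positivity) (by positivity)]
    have h1 : (a ^ 2 + y ^ 2) * (b ^ 2 + y ^ 2) ≤ (a ^ 2 + b ^ 2) * (y * (1 + y ^ 2)) := by
      have h2 : (a ^ 2 + y ^ 2) * (b ^ 2 + y ^ 2) ≤ (a ^ 2 + b ^ 2) * (2 * y ^ 2) := by
        have h3 : a ^ 2 ≤ y ^ 2 := by gcongr
        have h4 : y ^ 2 ≤ b ^ 2 := by gcongr
        nlinarith [mul_nonneg (sub_nonneg.2 h3) (sub_nonneg.2 h4)]
      refine h2.trans (mul_le_mul_of_nonneg_left ?_ (by positivity))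
      nlinarith [mul_nonneg hy.le (sq_nonneg (y - 1))]
    have h5 : 4 * g + s * (a + b) ≤ 2 * (1 + a * b) + s * (a + b) := by
      nlinarith [sq_nonneg (g - 1)]
    have h6 := mul_le_mul h1 h5 (by positivity) (by positivity)
    nlinarith [mul_le_mul_of_nonneg_left h6 (by positivity : 0 ≤ 2 * (b - a))]

/-- The cotangent of the argument is the quotient of the real and the imaginary part. -/
lemma cot_arg {z : ℂ} (hz : z ≠ 0) : Real.cot z.arg = z.re / z.im := by
  rw [Real.cot_eq_cos_div_sin, Complex.cos_arg hz, Complex.sin_arg,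
    div_div_div_cancel_right₀ (norm_ne_zero_iff.2 hz)]

/-- On `(0, π/2]`, an upper bound for `cot` is a lower bound for the angle. -/
lemma arccot_le_of_cot_le {t m : ℝ} (h0 : 0 < t) (h1 : t ≤ Real.pi / 2)
    (h : Real.cot t ≤ m) : arccot m ≤ t := by
  have htan : Real.tan (Real.pi / 2 - t) = Real.cot t := by
    rw [Real.tan_pi_div_two_sub, Real.cot_eq_cos_div_sin, Real.tan_eq_sin_div_cos, inv_div]
  have harc : Real.arctan (Real.cot t) = Real.pi / 2 - t := by
    rw [← htan]
    exact Real.arctan_tan (by linarith [Real.pi_pos]) (by linarith)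
  have := Real.arctan_strictMono.monotone h
  unfold arccot
  linarith

/-- Let `p ∈ (0,1)`, `0 < a < b`, `ψ(z) = ((z+p)/(z+1/p))²`,
`A = ψ(a)`, `B = ψ(b)`. For every `y ∈ [a,b]`, with `ζ = ψ(iy)`, the angle
`θ = arg((B − ζ)/(A − ζ)) ∈ (0, π/2]` subtended by `[A,B]` at `ζ` satisfies
`cot θ ≤ M_p(b/a)`; equivalently `θ ≥ arccot M_p(b/a)`. -/
theorem statement18 (p a b y : ℝ) (hp : p ∈ Set.Ioo (0 : ℝ) 1)
    (ha : 0 < a) (hab : a < b) (hy : y ∈ Set.Icc a b) :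
    Complex.arg ((psi p (b : ℂ) - psi p ((y : ℂ) * Complex.I)) /
        (psi p (a : ℂ) - psi p ((y : ℂ) * Complex.I))) ∈ Set.Ioc 0 (Real.pi / 2) ∧
    Real.cot (Complex.arg ((psi p (b : ℂ) - psi p ((y : ℂ) * Complex.I)) /
        (psi p (a : ℂ) - psi p ((y : ℂ) * Complex.I)))) ≤ Mp p (b / a) ∧
    arccot (Mp p (b / a)) ≤
      Complex.arg ((psi p (b : ℂ) - psi p ((y : ℂ) * Complex.I)) /
        (psi p (a : ℂ) - psi p ((y : ℂ) * Complex.I))) := by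
  obtain ⟨hp0, hp1⟩ := hp
  obtain ⟨hay, hyb⟩ := hy
  have hb : 0 < b := ha.trans hab
  have hy : 0 < y := ha.trans_le hay
  have hD : 0 < b - a := sub_pos.2 hab
  have hbound := cot_bound_le_Mp p a b y hp0 ha hab hay hyb
  obtain ⟨c, hc, hw⟩ := exists_psi_ratio_eq p a b y hp0 hp1 ha hb hy
  rw [hw, Complex.arg_real_mul _ hc]
  set R : ℝ := (a * b + y ^ 2) * (1 + y ^ 2) * (4 * (1 + a * b) + 2 * (p + 1 / p) * (a + b)) +
    (1 / p - p) ^ 2 * ((a ^ 2 + y ^ 2) * (b ^ 2 + y ^ 2))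
  set J : ℝ := y * (b - a) * (1 + y ^ 2) * (4 * (1 + a * b) + 2 * (p + 1 / p) * (a + b))
  have hR0 : 0 ≤ R := by positivity
  have hJ0 : 0 < J := by positivity
  obtain ⟨w, hwdef⟩ : ∃ w : ℂ, w = (R : ℂ) + (J : ℂ) * Complex.I := ⟨_, rfl⟩
  rw [← hwdef]
  have hre : w.re = R := by simp [hwdef]
  have him : w.im = J := by simp [hwdef]
  have hw0 : w ≠ 0 := by
    rintro rfl
    exact hJ0.ne him
  have h0 : 0 < w.arg := by
    refine lt_of_le_of_ne (Complex.arg_nonneg_iff.2 (him ▸ hJ0.le)) fun h => ?_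
    exact hJ0.ne' (him ▸ (Complex.arg_eq_zero_iff.1 h.symm).2)
  have h1 : w.arg ≤ Real.pi / 2 :=
    (le_abs_self _).trans (Complex.abs_arg_le_pi_div_two_iff.2 (hre ▸ hR0))
  have h2 : Real.cot w.arg ≤ Mp p (b / a) := by
    rw [cot_arg hw0, hre, him]
    exact hbound
  exact ⟨⟨h0, h1⟩, h2, arccot_le_of_cot_le h0 h1 h2⟩

end
end
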